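/- Let σ be a primitive substitution on 𝒜 = {a,b}. Then σ is invertible if and only if there exist k ≥ 1, m ≥ 1 and nonnegative integers a₁, …, a_m such that σ^k is conjugate to the composition L^{a₁} ∘ E ∘ L^{a₂} ∘ E ∘ L^{a₃} ∘ ⋯ ∘ E ∘ L^{a_m}, where E is the substitution a ↦ b, b ↦ a and L is the substitution a ↦ a, b ↦ ab. -/

import Mathlib

open scoped Matrix

/-- The two-letter alphabet `𝒜 = {a, b}`; the letter `a` is `0` and the letter `b` is `1`. -/
abbrev A2 := Fin 2

/-- A substitution on the two-letter alphabet, given by the images of the two letters.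
(The nonerasing condition is stated separately as `TwoSubst.NonErasing`.) -/
abbrev Subst := A2 → List A2

namespace TwoSubst

/-- A substitution is non-erasing if the images of the letters are nonempty words. -/
def NonErasing (σ : Subst) : Prop := ∀ i : A2, σ i ≠ []

/-- The extension of a substitution to finite words (the morphism of the free monoid). -/
def apply (σ : Subst) (w : List A2) : List A2 := w.flatMap σ

/-- The `n`-th power `σ^n` of a substitution (as a substitution). -/
def substPow (σ : Subst) (n : ℕ) : Subst := fun i => (apply σ)^[n] [i]

/-- Composition of substitutions: `(σ ∘ τ)(i) = σ(τ(i))`. -/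
def comp (σ τ : Subst) : Subst := fun i => apply σ (τ i)

/-- The substitution matrix `M_σ`: entry `(i, j)` is the number of occurrences of the
letter `i` in `σ(j)`. -/
def M (σ : Subst) : Matrix (Fin 2) (Fin 2) ℤ := fun i j => ((σ j).count i : ℤ)

/-- A substitution is primitive if some power of its substitution matrix has all
entries positive. -/
def Primitive (σ : Subst) : Prop := ∃ n : ℕ, 0 < n ∧ ∀ i j, 0 < (M σ ^ n) i j

/-- A finite word, regarded as an element of the free group `F₂`. -/
def toFG (w : List A2) : FreeGroup A2 := (w.map FreeGroup.of).prod

/-- The endomorphism of the free group `F₂` induced by a substitution. -/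
def endo (σ : Subst) : Monoid.End (FreeGroup A2) := FreeGroup.lift fun i => toFG (σ i)

/-- A substitution is invertible if its extension to the free group `F₂` is an
automorphism of `F₂`. -/
def IsInvertible (σ : Subst) : Prop := Function.Bijective (endo σ)

/-- Two substitutions are conjugate, `σ ~ ρ`, if `σ = γ_w ∘ ρ` as endomorphisms of `F₂`
for some `w ∈ F₂`, where `γ_w x = w * x * w⁻¹`. -/
def Conj (σ ρ : Subst) : Prop := ∃ w : FreeGroup A2, ∀ x, endo σ x = w * endo ρ x * w⁻¹

/-- `w` is a (finite) factor of the bi-infinite word `u : ℤ → A2`. -/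
def IsFactor (w : List A2) (u : ℤ → A2) : Prop :=
  ∃ k : ℤ, w = (List.range w.length).map fun i => u (k + i)

/-- The hull `X_σ`: the set of bi-infinite words all of whose finite factors appear as
factors of `σ^n(a)` or `σ^n(b)` for some `n ∈ ℕ`. -/
def Hull (σ : Subst) : Set (ℤ → A2) :=
  { u | ∀ w : List A2, IsFactor w u → ∃ (n : ℕ) (x : A2), w <:+: substPow σ n x }

/-- The substitution `E : a ↦ b, b ↦ a`. -/
def Esub : Subst := ![[1], [0]]

/-- The substitution `L : a ↦ a, b ↦ ab`. -/
def Lsub : Subst := ![[0], [0, 1]]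

/-- The composition `L^{a₁} ∘ E ∘ L^{a₂} ∘ E ∘ ⋯ ∘ E ∘ L^{a_m}` encoded by the
nonempty list of exponents `a₁ :: [a₂, …, a_m]`. -/
def chain : ℕ → List ℕ → Subst
  | a, [] => substPow Lsub a
  | a, b :: rest => comp (substPow Lsub a) (comp Esub (chain b rest))

/-- The letter-exchange map `a ↦ b, b ↦ a` on letters. -/
def swapA : A2 → A2 := fun i => if i = 0 then 1 else 0

/-- The substitution matrix with real entries. -/
noncomputable def Mreal (σ : Subst) : Matrix (Fin 2) (Fin 2) ℝ := (M σ).map fun z => (z : ℝ)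

/-- `lam` is the inflation factor (Perron–Frobenius eigenvalue) of `σ`: it is an
eigenvalue of `M_σ` admitting a positive eigenvector. -/
def IsInflation (σ : Subst) (lam : ℝ) : Prop :=
  ∃ v : Fin 2 → ℝ, (∀ i, 0 < v i) ∧ (Mreal σ).mulVec v = lam • v

/-- `α` is the frequency of `σ`: `α ∈ (0,1)` and `(1-α, α)` is an eigenvector of `M_σ`
for an eigenvalue with positive eigenvector (necessarily the Perron-Frobenius
eigenvalue, i.e. the inflation factor, when `σ` is primitive). -/
def IsFreq (σ : Subst) (α : ℝ) : Prop :=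
  0 < α ∧ α < 1 ∧ ∃ lam : ℝ, (Mreal σ).mulVec ![1 - α, α] = lam • ![1 - α, α]

/-- The automorphism `τ_a : a ↦ a⁻¹, b ↦ b` of the free group `F₂`. -/
def tauA : Monoid.End (FreeGroup A2) :=
  FreeGroup.lift fun i : A2 => if i = 0 then (FreeGroup.of (0 : A2))⁻¹ else FreeGroup.of 1

/-- `ρ` is the reciprocal substitution `σ̄ = τ_a ∘ σ⁻¹ ∘ τ_a⁻¹` of `σ`, where
`φ` is the inverse automorphism `σ⁻¹` (note `τ_a⁻¹ = τ_a`). -/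
def IsReciprocal (σ ρ : Subst) (φ : Monoid.End (FreeGroup A2)) : Prop :=
  (∀ x, φ (endo σ x) = x) ∧ (∀ x, endo σ (φ x) = x) ∧
    NonErasing ρ ∧ ∀ x, endo ρ x = tauA (φ (tauA x))

/-- `σ` is a selfdual substitution (relative to its reciprocal `ρ = σ̄`):
`σ ~ σ̄` or `σ ~ E ∘ σ̄ ∘ E`. -/
def SelfDual (σ ρ : Subst) : Prop :=
  Conj σ ρ ∨ Conj σ (comp Esub (comp ρ Esub))

/-! ### Strands and dual maps -/

/-- Integer vectors in the plane. -/
abbrev V2 := Fin 2 → ℤ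

/-- The abelianisation map `A : 𝒜* → ℤ²`, counting occurrences of each letter. -/
def Avec (w : List A2) : V2 := fun i => (w.count i : ℤ)

/-- The space `𝒢` (and its dual `𝒢*`): formal finite real linear combinations of the
basis elements `(W, i)` (resp. `(W, i*)`), `W ∈ ℤ²`, `i ∈ 𝒜`. -/
abbrev Gspace := (V2 × A2) →₀ ℝ

/-- The image of the basis element `(W, i)` under `E₁(σ)`. -/
noncomputable def E1Basis (σ : Subst) (p : V2 × A2) : Gspace :=
  ∑ k ∈ Finset.range (σ p.2).length,
    Finsupp.single ((M σ).mulVec p.1 + Avec ((σ p.2).take k), (σ p.2).getD k p.2) (1 : ℝ)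

/-- The one-dimensional extension `E₁(σ)`, as a linear map on `𝒢`. -/
noncomputable def E1 (σ : Subst) : Gspace →ₗ[ℝ] Gspace :=
  Finsupp.lift Gspace ℝ (V2 × A2) (E1Basis σ)

/-- The image of the basis element `(W, i*)` under the dual map `E₁*(σ)`:
`E₁*(σ)(W, i*) = Σ_{j,k : σ(j)_k = i} (M_σ⁻¹·(W + A(σ(j)_{k+1}⋯σ(j)_{|σ(j)|})), j*)`. -/
noncomputable def E1starBasis (σ : Subst) (p : V2 × A2) : Gspace :=
  ∑ j : A2, ∑ k ∈ Finset.range (σ j).length,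
    if (σ j).getD k j = p.2 then
      Finsupp.single ((M σ)⁻¹.mulVec (p.1 + Avec ((σ j).drop (k + 1))), j) (1 : ℝ)
    else 0

/-- The dual map `E₁*(σ)`, as a linear map on `𝒢*`. -/
noncomputable def E1star (σ : Subst) : Gspace →ₗ[ℝ] Gspace :=
  Finsupp.lift Gspace ℝ (V2 × A2) (E1starBasis σ)

/-- The basis vector `e_a = (1,0)`. -/
def ea : V2 := ![1, 0]

/-- The basis vector `e_b = (0,1)`. -/
def eb : V2 := ![0, 1]

/-- `γ(0), …, γ(n)` is a finite dual strand: each step is `e_a` or `-e_b`. -/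
def IsDualStrand (n : ℕ) (γ : ℕ → V2) : Prop :=
  ∀ k < n, γ (k + 1) - γ k = ea ∨ γ (k + 1) - γ k = -eb

/-- The element of `𝒢*` associated with a finite dual strand `γ(0), …, γ(n)`:
the sum of `(γ(k), b*)` over the `e_a`-steps and `(γ(k+1), a*)` over the `-e_b`-steps
(the letter `a` is `0`, the letter `b` is `1`). -/
noncomputable def strandElem (n : ℕ) (γ : ℕ → V2) : Gspace :=
  ∑ k ∈ Finset.range n,
    if γ (k + 1) - γ k = ea then Finsupp.single (γ k, (1 : A2)) (1 : ℝ)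
    else Finsupp.single (γ (k + 1), (0 : A2)) (1 : ℝ)

/-! ### Endomorphisms of the free group -/

/-- The exponent-sum homomorphism of the generator `i` on `F₂`. -/
def expSum (i : A2) : FreeGroup A2 →* Multiplicative ℤ :=
  FreeGroup.lift fun j : A2 => Multiplicative.ofAdd (if j = i then (1 : ℤ) else 0)

/-- The abelianised matrix of an endomorphism of `F₂`: entry `(i,j)` is the exponent
sum of the generator `i` in the image of the generator `j`. -/
def abelMatrix (σ : Monoid.End (FreeGroup A2)) : Matrix (Fin 2) (Fin 2) ℤ :=
  fun i j => Multiplicative.toAdd (expSum i (σ (FreeGroup.of j)))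

/-- `wprod ρ w k = w · ρ(w) · ρ²(w) ⋯ ρ^{k−1}(w)`. -/
def wprod (ρ : Monoid.End (FreeGroup A2)) (w : FreeGroup A2) : ℕ → FreeGroup A2
  | 0 => 1
  | k + 1 => wprod ρ w k * (ρ ^ k) w

end TwoSubst


namespace TwoSubst

/-! ### Basic facts -/

theorem endo_of (σ : Subst) (i : A2) : endo σ (FreeGroup.of i) = toFG (σ i) :=
  FreeGroup.lift_apply_of

theorem end_mul_apply (f g : Monoid.End (FreeGroup A2)) (x : FreeGroup A2) :
    (f * g) x = f (g x) := rfl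

/-- Inner automorphism as an endomorphism. -/
def inn (v : FreeGroup A2) : Monoid.End (FreeGroup A2) := (MulAut.conj v).toMonoidHom

theorem inn_apply (v x : FreeGroup A2) : inn v x = v * x * v⁻¹ := rfl

theorem inn_bij (v : FreeGroup A2) : Function.Bijective (inn v) := (MulAut.conj v).bijective

theorem toFG_append (u v : List A2) : toFG (u ++ v) = toFG u * toFG v := by
  simp [toFG]

theorem toFG_nil : toFG [] = 1 := by simp [toFG]

theorem toFG_cons (x : A2) (v : List A2) : toFG (x :: v) = FreeGroup.of x * toFG v := by
  simp [toFG]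

theorem endo_toFG (σ : Subst) (w : List A2) : endo σ (toFG w) = toFG (apply σ w) := by
  induction w with
  | nil => simp [toFG, apply]
  | cons x w ih =>
    rw [toFG_cons, map_mul, ih, endo_of]
    simp [apply, toFG_append]

theorem end_ext {f g : Monoid.End (FreeGroup A2)} (h : ∀ i, f (FreeGroup.of i) = g (FreeGroup.of i)) :
    f = g := FreeGroup.ext_hom f g h

theorem endo_comp (σ τ : Subst) : endo (comp σ τ) = endo σ * endo τ := by
  apply end_ext
  intro i
  rw [end_mul_apply, endo_of, endo_of, endo_toFG]
  rfl

theorem endo_substPow (σ : Subst) (n : ℕ) : endo (substPow σ n) = endo σ ^ n := by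
  induction n with
  | zero =>
    apply end_ext
    intro i
    simp [endo_of, substPow, toFG]
  | succ n ih =>
    apply end_ext
    intro i
    rw [pow_succ', end_mul_apply, ← ih, endo_of, endo_of, endo_toFG]
    simp only [substPow, Function.iterate_succ', Function.comp]

/-- Conjugate to a chain. -/
def PC (f : Monoid.End (FreeGroup A2)) : Prop :=
  ∃ (a : ℕ) (rest : List ℕ) (w : FreeGroup A2), ∀ x, f x = w * endo (chain a rest) x * w⁻¹

theorem chain_mul_L (a : ℕ) (rest : List ℕ) :
    ∃ a' rest', endo (chain a' rest') = endo (chain a rest) * endo Lsub := by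
  induction rest generalizing a with
  | nil => exact ⟨a + 1, [], by simp [chain, endo_substPow, pow_succ]⟩
  | cons b r ih =>
    obtain ⟨b', r', h⟩ := ih b
    exact ⟨a, b' :: r', by simp [chain, endo_comp, h, mul_assoc]⟩

theorem chain_mul_E (a : ℕ) (rest : List ℕ) :
    ∃ a' rest', endo (chain a' rest') = endo (chain a rest) * endo Esub := by
  induction rest generalizing a with
  | nil => exact ⟨a, [0], by simp [chain, endo_comp, endo_substPow]⟩
  | cons b r ih =>
    obtain ⟨b', r', h⟩ := ih b
    exact ⟨a, b' :: r', by simp [chain, endo_comp, h, mul_assoc]⟩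

theorem PC_mul_L {f} (h : PC f) : PC (f * endo Lsub) := by
  obtain ⟨a, r, w, h⟩ := h
  obtain ⟨a', r', h'⟩ := chain_mul_L a r
  exact ⟨a', r', w, fun x => by rw [h', end_mul_apply, h, end_mul_apply]⟩

theorem PC_mul_E {f} (h : PC f) : PC (f * endo Esub) := by
  obtain ⟨a, r, w, h⟩ := h
  obtain ⟨a', r', h'⟩ := chain_mul_E a r
  exact ⟨a', r', w, fun x => by rw [h', end_mul_apply, h, end_mul_apply]⟩

theorem PC_conj {f g : Monoid.End (FreeGroup A2)} (h : PC f) (v : FreeGroup A2)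
    (hv : ∀ i, g (FreeGroup.of i) = v * f (FreeGroup.of i) * v⁻¹) : PC g := by
  obtain ⟨a, r, w, h⟩ := h
  have : g = inn v * f :=
    end_ext fun i => by rw [hv, end_mul_apply, inn_apply]
  refine ⟨a, r, v * w, fun x => ?_⟩
  rw [this, end_mul_apply, inn_apply, h]
  simp [mul_assoc]

theorem PC_one : PC 1 := ⟨0, [], 1, fun x => by simp [chain, endo_substPow]⟩

theorem E_sq : endo Esub * endo Esub = 1 := by
  apply end_ext
  intro i
  fin_cases i <;> simp [endo_of, Esub, toFG]

theorem E_bij : Function.Bijective (endo Esub) := by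
  have h : ∀ x, endo Esub (endo Esub x) = x := fun x => by
    rw [← end_mul_apply, E_sq]; rfl
  exact Function.Involutive.bijective h

/-- Inverse of `L`. -/
def Linv : Monoid.End (FreeGroup A2) :=
  FreeGroup.lift ![FreeGroup.of 0, (FreeGroup.of 0)⁻¹ * FreeGroup.of 1]

theorem Linv_of (i : A2) : Linv (FreeGroup.of i) =
    (![FreeGroup.of 0, (FreeGroup.of 0)⁻¹ * FreeGroup.of 1] : A2 → FreeGroup A2) i :=
  FreeGroup.lift_apply_of

theorem L_bij : Function.Bijective (endo Lsub) := by
  have h1 : endo Lsub * Linv = 1 := by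
    apply end_ext
    intro i
    rw [end_mul_apply, Linv_of]
    fin_cases i <;> simp [endo_of, Lsub, toFG]
  have h2 : Linv * endo Lsub = 1 := by
    apply end_ext
    intro i
    rw [end_mul_apply, endo_of]
    fin_cases i <;> simp [Linv_of, Lsub, toFG]
  refine Function.bijective_iff_has_inverse.2 ⟨Linv, fun x => ?_, fun x => ?_⟩
  · rw [← end_mul_apply, h2]; rfl
  · rw [← end_mul_apply, h1]; rfl

theorem pow_bij {f : Monoid.End (FreeGroup A2)} (h : Function.Bijective f) (n : ℕ) :
    Function.Bijective (f ^ n) := by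
  rw [Monoid.End.coe_pow]; exact h.iterate n

theorem chain_bij (a : ℕ) (rest : List ℕ) : Function.Bijective (endo (chain a rest)) := by
  induction rest generalizing a with
  | nil =>
    simp only [chain, endo_substPow]; exact pow_bij L_bij a
  | cons b r ih =>
    simp only [chain, endo_comp, endo_substPow, Monoid.End.coe_mul]
    exact (pow_bij L_bij a).comp (E_bij.comp (ih b))

/-! ### Lists -/

theorem split_lemma (l1 l2 : List A2) : l1 <+: l2 ∨ l2 <+: l1 ∨
    ∃ p x y t t', x ≠ y ∧ l1 = p ++ x :: t ∧ l2 = p ++ y :: t' := by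
  induction l1 generalizing l2 with
  | nil => simp
  | cons a l1 ih =>
    cases l2 with
    | nil => simp
    | cons b l2 =>
      by_cases hab : a = b
      · subst hab
        rcases ih l2 with h | h | ⟨p, x, y, t, t', h, h1, h2⟩
        · left; simpa using h
        · right; left; simpa using h
        · right; right
          exact ⟨a :: p, x, y, t, t', h, by simp [h1], by simp [h2]⟩
      · right; right
        exact ⟨[], a, b, l1, l2, hab, rfl, rfl⟩

theorem split_suffix (l1 l2 : List A2) : l1 <:+ l2 ∨ l2 <:+ l1 ∨
    ∃ p x y t t', x ≠ y ∧ l1 = t ++ x :: p ∧ l2 = t' ++ y :: p := by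
  rcases split_lemma l1.reverse l2.reverse with h | h | ⟨p, x, y, t, t', h, h1, h2⟩
  · left; simpa using h
  · right; left; simpa using h
  · right; right
    refine ⟨p.reverse, x, y, t.reverse, t'.reverse, h, ?_, ?_⟩
    · rw [← List.reverse_inj, h1]; simp
    · rw [← List.reverse_inj, h2]; simp

/-! ### The non-generation lemma -/

def pos (w : List A2) : List (A2 × Bool) := w.map fun x => (x, true)
def neg (w : List A2) : List (A2 × Bool) := w.reverse.map fun x => (x, false)

theorem mk_pos (w : List A2) : FreeGroup.mk (pos w) = toFG w := by
  induction w with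
  | nil => rfl
  | cons x w ih =>
    rw [toFG_cons, ← ih, FreeGroup.of, FreeGroup.mul_mk]; rfl

theorem mk_neg (w : List A2) : FreeGroup.mk (neg w) = (toFG w)⁻¹ := by
  rw [← mk_pos, FreeGroup.inv_mk]
  simp [FreeGroup.invRev, pos, neg, Function.comp_def]

def nextneg : List (A2 × Bool) → Bool
  | [] => false
  | (_, e) :: _ => !e

def HH (p : A2 → List A2) (s : List A2) : Bool → List (A2 × Bool) → List (A2 × Bool)
  | _, [] => []
  | _, (x, true) :: r => pos (p x ++ (if nextneg r then [] else s)) ++ HH p s true r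
  | b, (x, false) :: r => neg (p x ++ (if b then [] else s)) ++ HH p s false r

theorem mk_HH (p : A2 → List A2) (s : List A2) (b : Bool) (L : List (A2 × Bool)) :
    FreeGroup.mk (HH p s b L) = (if b && nextneg L then toFG s else 1) *
      endo (fun i => p i ++ s) (FreeGroup.mk L) := by
  induction L generalizing b with
  | nil => simp [HH, nextneg, ← FreeGroup.one_eq_mk]
  | cons z r ih =>
    obtain ⟨x, e⟩ := z
    have hz : ∀ e, (FreeGroup.mk ((x, e) :: r) : FreeGroup A2) =
        FreeGroup.mk [(x, e)] * FreeGroup.mk r := fun e => by rw [FreeGroup.mul_mk]; rfl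
    cases e
    · have h1 : (FreeGroup.mk [(x, false)] : FreeGroup A2) = (FreeGroup.of x)⁻¹ := rfl
      rw [hz, h1, map_mul, map_inv, endo_of, HH, ← FreeGroup.mul_mk, ih, mk_neg]
      cases b <;> simp [nextneg, toFG_append, toFG_nil, mul_assoc]
    · have h1 : (FreeGroup.mk [(x, true)] : FreeGroup A2) = FreeGroup.of x := rfl
      rw [hz, h1, map_mul, endo_of, HH, ← FreeGroup.mul_mk, ih, mk_pos]
      cases h : nextneg r <;> simp [nextneg, toFG_append, toFG_nil, mul_assoc]

theorem HH_length (p : A2 → List A2) (s : List A2) (hp : ∀ i, p i ≠ []) (b : Bool)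
    (L : List (A2 × Bool)) : L.length ≤ (HH p s b L).length := by
  induction L generalizing b with
  | nil => simp [HH]
  | cons z r ih =>
    obtain ⟨x, e⟩ := z
    have := List.length_pos_iff.2 (hp x)
    cases e
    · have := ih false
      simp [HH, neg]; omega
    · have := ih true
      simp [HH, pos]; omega

theorem HH_head (p : A2 → List A2) (s : List A2) (hd lst : A2 → A2)
    (hhd : ∀ i, ∃ t, p i = hd i :: t) (hlst : ∀ i, ∃ t, p i = t ++ [lst i]) (b : Bool)
    (L : List (A2 × Bool)) (y) (hy : y ∈ (HH p s b L).head?) :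
    ∃ z ∈ L.head?, y.2 = z.2 ∧ (z.2 = true → y.1 = hd z.1) ∧
      (z.2 = false → b = true → y.1 = lst z.1) := by
  match L with
  | [] => simp [HH] at hy
  | (x, true) :: r =>
    obtain ⟨t, ht⟩ := hhd x
    simp [HH, pos, ht] at hy
    subst hy
    simp
  | (x, false) :: r =>
    obtain ⟨t, ht⟩ := hlst x
    refine ⟨(x, false), by simp, ?_⟩
    cases b
    · rw [HH, List.head?_append_of_ne_nil _ (by simp [neg, ht])] at hy
      have := List.mem_of_mem_head? hy
      obtain ⟨c, _, hc⟩ := List.mem_map.1 this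
      subst hc
      simp
    · simp [HH, neg, ht] at hy
      subst hy
      simp

theorem chain_const (l : List (A2 × Bool)) (e : Bool) (h : ∀ z ∈ l, z.2 = e) :
    FreeGroup.IsReduced l := by
  induction l with
  | nil => simp [FreeGroup.IsReduced]
  | cons z l ih =>
    cases l with
    | nil => simp [FreeGroup.IsReduced]
    | cons z' l =>
      have := ih (fun z hz => h z (by simp [hz]))
      unfold FreeGroup.IsReduced at *
      rw [List.isChain_cons_cons]
      refine ⟨fun _ => ?_, this⟩
      rw [h z (by simp), h z' (by simp)]

theorem HH_reduced (p : A2 → List A2) (s : List A2) (hd lst : A2 → A2)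
    (hhd : ∀ i, ∃ t, p i = hd i :: t) (hlst : ∀ i, ∃ t, p i = t ++ [lst i])
    (hd_inj : Function.Injective hd) (lst_inj : Function.Injective lst) (b : Bool)
    (L : List (A2 × Bool)) (hL : FreeGroup.IsReduced L) : FreeGroup.IsReduced (HH p s b L) := by
  induction L generalizing b with
  | nil => simp [HH, FreeGroup.IsReduced]
  | cons z r ih =>
    have hr : FreeGroup.IsReduced r := by
      unfold FreeGroup.IsReduced at *
      exact hL.tail
    have hzr : ∀ z' ∈ r.head?, z.1 = z'.1 → z.2 = z'.2 := by
      unfold FreeGroup.IsReduced at hL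
      rw [List.isChain_cons] at hL
      exact hL.1
    obtain ⟨x, e⟩ := z
    cases e
    · rw [HH]
      unfold FreeGroup.IsReduced
      rw [List.isChain_append]
      refine ⟨chain_const _ false (by simp [neg]), ih false hr, ?_⟩
      intro y1 hy1 y2 hy2 h12
      obtain ⟨z', hz', h1, h2, h3⟩ := HH_head p s hd lst hhd hlst false r y2 hy2
      obtain ⟨t, ht⟩ := hhd x
      simp [neg, ht] at hy1
      subst hy1
      have := hzr z' hz'
      rw [h1]
      cases hz2 : z'.2
      · rfl
      · rw [h2 hz2] at h12
        have := this (hd_inj h12)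
        simp [hz2] at this
    · rw [HH]
      unfold FreeGroup.IsReduced
      rw [List.isChain_append]
      refine ⟨chain_const _ true (by simp [pos]), ih true hr, ?_⟩
      intro y1 hy1 y2 hy2 h12
      obtain ⟨z', hz', h1, h2, h3⟩ := HH_head p s hd lst hhd hlst true r y2 hy2
      have := hzr z' hz'
      have hy1t : y1.2 = true := by
        have := List.mem_of_mem_getLast? hy1
        obtain ⟨c, _, hc⟩ := List.mem_map.1 this
        rw [← hc]
      rw [h1, hy1t]
      cases hz2 : z'.2
      · have hn : nextneg r = true := by
          cases r with
          | nil => simp at hz'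
          | cons q r =>
            simp at hz'
            subst hz'
            obtain ⟨q1, q2⟩ := q
            simp at hz2
            simp [nextneg, hz2]
        obtain ⟨t, ht⟩ := hlst x
        simp [pos, ht, hn] at hy1
        subst hy1
        rw [h3 hz2 rfl] at h12
        have := this (lst_inj h12)
        simp [hz2] at this
      · rfl

theorem nongen (p : A2 → List A2) (s : List A2) (hd lst : A2 → A2)
    (hhd : ∀ i, ∃ t, p i = hd i :: t) (hlst : ∀ i, ∃ t, p i = t ++ [lst i])
    (hd_inj : Function.Injective hd) (lst_inj : Function.Injective lst)
    (hs : Function.Surjective (endo (fun i => p i ++ s))) (c : A2) :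
    ∃ x, p x ++ s = [c] := by
  obtain ⟨g, hg⟩ := hs (FreeGroup.of c)
  have hp : ∀ i, p i ≠ [] := fun i => by obtain ⟨t, ht⟩ := hhd i; simp [ht]
  have hred := HH_reduced p s hd lst hhd hlst hd_inj lst_inj false g.toWord
    FreeGroup.isReduced_toWord
  have hmk := mk_HH p s false g.toWord
  rw [FreeGroup.mk_toWord, hg] at hmk
  have h1 : HH p s false g.toWord = [(c, true)] := by
    have := congrArg FreeGroup.toWord hmk
    rw [FreeGroup.toWord_mk, hred.reduce_eq] at this
    simpa using this
  have hlen := HH_length p s hp false g.toWord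
  rw [h1] at hlen
  match hw : g.toWord with
  | [] => rw [hw] at h1; simp [HH] at h1
  | [(x, true)] =>
    rw [hw] at h1
    simp only [HH, nextneg, pos] at h1
    refine ⟨x, ?_⟩
    have := congrArg (List.map Prod.fst) h1
    simpa [Function.comp_def] using this
  | [(x, false)] =>
    rw [hw] at h1
    have : (c, true) ∈ HH p s false [(x, false)] := by rw [h1]; simp
    simp [HH, neg] at this
  | _ :: _ :: _ => rw [hw] at hlen; simp at hlen

/-! ### The descent -/

theorem inv_ne_nil {σ : Subst} (h : IsInvertible σ) (i : A2) : σ i ≠ [] := by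
  intro hi
  have : endo σ (FreeGroup.of i) = endo σ 1 := by rw [endo_of, hi, map_one, toFG_nil]
  exact FreeGroup.of_ne_one i (h.1 this)

theorem inv_not_comm {σ : Subst} (h : IsInvertible σ) : σ 0 ++ σ 1 ≠ σ 1 ++ σ 0 := by
  intro hi
  have : endo σ (FreeGroup.of 0 * FreeGroup.of 1) = endo σ (FreeGroup.of 1 * FreeGroup.of 0) := by
    rw [map_mul, map_mul, endo_of, endo_of, ← toFG_append, hi, toFG_append]
  have := h.1 this
  revert this
  decide

theorem case_suffix (n : ℕ)
    (IH : ∀ σ : Subst, (σ 0).length + (σ 1).length < n → IsInvertible σ → PC (endo σ))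
    (σ : Subst) (hn : (σ 0).length + (σ 1).length ≤ n) (hσ : IsInvertible σ)
    (h : σ 0 <:+ σ 1) : PC (endo σ) := by
  obtain ⟨v, hv⟩ := h
  set τ : Subst := ![σ 0, v] with hτ
  have e0 : endo τ (FreeGroup.of 0) = toFG (σ 0) := by simp [endo_of, hτ]
  have e1 : endo τ (FreeGroup.of 1) = toFG v := by simp [endo_of, hτ]
  have hconj : ∀ i, endo σ (FreeGroup.of i) =
      (toFG (σ 0))⁻¹ * (endo τ * endo Lsub) (FreeGroup.of i) * (toFG (σ 0))⁻¹⁻¹ := by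
    intro i
    rw [end_mul_apply, endo_of, endo_of]
    fin_cases i
    · simp [Lsub, toFG_cons, toFG_nil, e0]
    · simp [Lsub, toFG_cons, toFG_nil, e0, e1, ← hv, toFG_append]
  have hτinv : IsInvertible τ := by
    have : endo τ * endo Lsub = inn (toFG (σ 0)) * endo σ :=
      end_ext fun i => by rw [end_mul_apply (inn _), inn_apply, hconj]; group
    have hb : Function.Bijective (endo τ * endo Lsub) := by
      rw [this, Monoid.End.coe_mul]
      exact (inn_bij _).comp hσ
    rw [Monoid.End.coe_mul] at hb
    exact (Function.Bijective.of_comp_iff _ L_bij).1 hb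
  have hlen : (τ 0).length + (τ 1).length < n := by
    have := List.length_pos_iff.2 (inv_ne_nil hσ 0)
    have h2 := congrArg List.length hv
    simp at h2
    simp [hτ]; omega
  exact PC_conj (PC_mul_L (IH τ hlen hτinv)) _ hconj

theorem descent_heads (n : ℕ)
    (IH : ∀ σ : Subst, (σ 0).length + (σ 1).length < n → IsInvertible σ → PC (endo σ))
    (σ : Subst) (hn : (σ 0).length + (σ 1).length ≤ n) (hσ : IsInvertible σ)
    (c d : A2) (t t' : List A2) (hcd : c ≠ d) (h0 : σ 0 = c :: t) (h1 : σ 1 = d :: t') :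
    PC (endo σ) := by
  have key : endo (comp σ Esub) = endo σ * endo Esub := endo_comp _ _
  have key2 : endo σ = endo (comp σ Esub) * endo Esub := by
    rw [key, mul_assoc, E_sq, mul_one]
  rcases split_suffix (σ 0) (σ 1) with h | h | ⟨s, x, y, q, q', hxy, hq, hq'⟩
  · exact case_suffix n IH σ hn hσ h
  · rw [key2]
    apply PC_mul_E
    have f0 : comp σ Esub 0 = σ 1 := by simp [comp, Esub, apply]
    have f1 : comp σ Esub 1 = σ 0 := by simp [comp, Esub, apply]
    apply case_suffix n IH
    · rw [f0, f1]; omega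
    · unfold IsInvertible
      rw [key, Monoid.End.coe_mul]
      exact hσ.comp E_bij
    · rw [f0, f1]; exact h
  · have hσe : σ = fun i => (![q ++ [x], q' ++ [y]] : Subst) i ++ s := by
      funext i
      fin_cases i
      · simp [hq]
      · simp [hq']
    have hng := nongen ![q ++ [x], q' ++ [y]] s ![c, d] ![x, y]
      (by
        intro i
        fin_cases i
        · rw [hq] at h0
          cases q <;> simp_all
        · rw [hq'] at h1
          cases q' <;> simp_all)
      (by intro i; fin_cases i <;> simp)
      (by intro i j; fin_cases i <;> fin_cases j <;> simp [hcd, hcd.symm])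
      (by intro i j; fin_cases i <;> fin_cases j <;> simp [hxy, hxy.symm])
      (by rw [← hσe]; exact hσ.2)
    have hng' : ∀ c, ∃ x, σ x = [c] := by
      intro c
      obtain ⟨x, hx⟩ := hng c
      exact ⟨x, by rw [hσe]; exact hx⟩
    obtain ⟨i, hi⟩ := hng' 0
    obtain ⟨j, hj⟩ := hng' 1
    have hor : (σ 0 = [0] ∧ σ 1 = [1]) ∨ (σ 0 = [1] ∧ σ 1 = [0]) := by
      fin_cases i <;> fin_cases j <;> simp_all
    rcases hor with ⟨g0, g1⟩ | ⟨g0, g1⟩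
    · have : endo σ = 1 := by
        apply end_ext
        intro i
        fin_cases i <;> simp [endo_of, g0, g1, toFG]
      rw [this]; exact PC_one
    · have : endo σ = 1 * endo Esub := by
        apply end_ext
        intro i
        fin_cases i <;> simp [endo_of, g0, g1, toFG, Esub]
      rw [this]; exact PC_mul_E PC_one

theorem descent_rot (n : ℕ)
    (IH : ∀ σ : Subst, (σ 0).length + (σ 1).length < n → IsInvertible σ → PC (endo σ))
    (p : List A2) : ∀ (σ : Subst), (σ 0).length + (σ 1).length ≤ n → IsInvertible σ →
    ∀ (x y : A2) (t t' : List A2), x ≠ y → σ 0 ++ σ 1 = p ++ x :: t →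
      σ 1 ++ σ 0 = p ++ y :: t' → PC (endo σ) := by
  induction p with
  | nil =>
    intro σ hn hσ x y t t' hxy h0 h1
    obtain ⟨c, u, hu⟩ := List.exists_cons_of_ne_nil (inv_ne_nil hσ 0)
    obtain ⟨d, v, hv⟩ := List.exists_cons_of_ne_nil (inv_ne_nil hσ 1)
    refine descent_heads n IH σ hn hσ c d u v ?_ hu hv
    rw [hu, hv] at h0 h1
    simp at h0 h1
    rw [h0.1, h1.1]; exact hxy
  | cons z p ih =>
    intro σ hn hσ x y t t' hxy h0 h1
    obtain ⟨c, u, hu⟩ := List.exists_cons_of_ne_nil (inv_ne_nil hσ 0)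
    obtain ⟨d, v, hv⟩ := List.exists_cons_of_ne_nil (inv_ne_nil hσ 1)
    rw [hu, hv] at h0 h1
    simp at h0 h1
    obtain ⟨rfl, h0⟩ := h0
    obtain ⟨rfl, h1⟩ := h1
    set τ : Subst := ![u ++ [d], v ++ [d]] with hτ
    have hconj : ∀ i, endo σ (FreeGroup.of i) =
        FreeGroup.of d * endo τ (FreeGroup.of i) * (FreeGroup.of d)⁻¹ := by
      intro i
      rw [endo_of, endo_of]
      fin_cases i
      · simp [hτ, hu, toFG_append, toFG_cons, toFG_nil, mul_assoc]
      · simp [hτ, hv, toFG_append, toFG_cons, toFG_nil, mul_assoc]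
    have hτinv : IsInvertible τ := by
      have : endo τ = inn (FreeGroup.of d)⁻¹ * endo σ :=
        end_ext fun i => by rw [end_mul_apply, inn_apply, hconj]; group
      unfold IsInvertible
      rw [this, Monoid.End.coe_mul]
      exact (inn_bij _).comp hσ
    refine PC_conj (ih τ ?_ hτinv x y (t ++ [d]) (t' ++ [d]) hxy ?_ ?_) _ hconj
    · simp [hu, hv] at hn
      simp [hτ]; omega
    · have := congrArg (· ++ [d]) h0
      simpa [hτ] using this
    · have := congrArg (· ++ [d]) h1
      simpa [hτ] using this

theorem inv_PC (n : ℕ) : ∀ σ : Subst, (σ 0).length + (σ 1).length < n → IsInvertible σ →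
    PC (endo σ) := by
  induction n with
  | zero => intro σ h; omega
  | succ n ih =>
    intro σ hn hσ
    have hc := inv_not_comm hσ
    have hl : (σ 0 ++ σ 1).length = (σ 1 ++ σ 0).length := by simp [add_comm]
    rcases split_lemma (σ 0 ++ σ 1) (σ 1 ++ σ 0) with h | h | ⟨p, x, y, t, t', h, h1, h2⟩
    · exact absurd (h.eq_of_length hl) hc
    · exact absurd (h.eq_of_length hl.symm).symm hc
    · exact descent_rot n ih p σ (by omega) hσ x y t t' h h1 h2

end TwoSubst

open TwoSubst in
/-- A primitive substitution on two letters is invertible if and only if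
some power `σ^k` (`k ≥ 1`) is conjugate to a composition
`L^{a₁} ∘ E ∘ L^{a₂} ∘ E ∘ ⋯ ∘ E ∘ L^{a_m}` with `m ≥ 1` and `a₁, …, a_m ∈ ℕ`
(the nonempty list `a₁ :: rest` encodes `a₁, …, a_m`). -/
theorem invertible_iff_conj_chain (σ : Subst) (hne : NonErasing σ) (hprim : Primitive σ) :
    IsInvertible σ ↔
      ∃ (k : ℕ) (a : ℕ) (rest : List ℕ), 1 ≤ k ∧ Conj (substPow σ k) (chain a rest) := by
  constructor
  · intro h
    obtain ⟨a, rest, w, hw⟩ := inv_PC _ σ (Nat.lt_succ_self _) h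
    exact ⟨1, a, rest, le_refl _, w, fun x => by rw [endo_substPow, pow_one]; exact hw x⟩
  · rintro ⟨k, a, rest, hk, w, hw⟩
    have hb : Function.Bijective (endo (substPow σ k)) := by
      have : (endo (substPow σ k) : FreeGroup A2 → FreeGroup A2) =
          (MulAut.conj w) ∘ (endo (chain a rest)) := by
        funext x
        rw [hw]; simp
      rw [this]
      exact (MulAut.conj w).bijective.comp (chain_bij a rest)
    rw [endo_substPow] at hb
    obtain ⟨m, rfl⟩ : ∃ m, k = m + 1 := ⟨k - 1, by omega⟩
    constructor
    · have := hb.1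
      rw [pow_succ, Monoid.End.coe_mul] at this
      exact this.of_comp
    · have := hb.2
      rw [pow_succ', Monoid.End.coe_mul] at this
      exact this.of_comp
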